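/- For every |d| < 1 and every μ ∈ ℝ, the function (y,s) ↦ κ̄*(d,μ,y,s) = κ*(d, μe^{s}, y) is a solution of the first-order vector-valued formulation of the one-dimensional similarity equation on its domain of definition; equivalently, for all |d| < 1, ν > −1+|d| and |y| < 1, the pair κ* = (κ₁*, κ₂*)(d,ν,y) satisfies ν∂_ν κ₁* = κ₂* and ν∂_ν κ₂* = 𝓛κ₁* − (2(p+1)/(p−1)²)κ₁* + (κ₁*)^p − ((p+3)/(p−1))κ₂* − 2y∂_yκ₂*. In particular, for ν = 0, the soliton κ(d,y) = κ₁*(d,0,y) is a stationary solution: 𝓛κ(d) − (2(p+1)/(p−1)²)κ(d) + κ(d)^p = 0 on (−1,1). -/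

import Mathlib

noncomputable section

open Real MeasureTheory Set Filter Asymptotics

/-- The weight `ρ(y) = (1-y²)^{2/(p-1)}`. -/
def rho (p y : ℝ) : ℝ := (1 - y ^ 2) ^ ((2 : ℝ) / (p - 1))

/-- `κ₀ = (2(p+1)/(p-1)²)^{1/(p-1)}`. -/
def kappa0 (p : ℝ) : ℝ := (2 * (p + 1) / (p - 1) ^ 2) ^ ((1 : ℝ) / (p - 1))

/-- The soliton `κ(d,y) = κ₀((1-d²)/(1+dy)²)^{1/(p-1)}`. -/
def kappaSol (p d y : ℝ) : ℝ :=
  kappa0 p * ((1 - d ^ 2) / (1 + d * y) ^ 2) ^ ((1 : ℝ) / (p - 1))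

/-- First component of the generalized soliton `κ*`. -/
def kappaStar1 (p d ν y : ℝ) : ℝ :=
  kappa0 p * (1 - d ^ 2) ^ ((1 : ℝ) / (p - 1)) / (1 + d * y + ν) ^ ((2 : ℝ) / (p - 1))

/-- Second component of the generalized soliton `κ*`. -/
def kappaStar2 (p d ν y : ℝ) : ℝ :=
  -(2 * kappa0 p * ν / (p - 1)) * (1 - d ^ 2) ^ ((1 : ℝ) / (p - 1)) /
    (1 + d * y + ν) ^ ((p + 1) / (p - 1))

/-- The generalized soliton as a pair of functions of `y`. -/
def kappaStarPair (p d ν : ℝ) : (ℝ → ℝ) × (ℝ → ℝ) :=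
  (fun y => kappaStar1 p d ν y, fun y => kappaStar2 p d ν y)

/-- Difference of pairs of functions. -/
def pairSub (v w : (ℝ → ℝ) × (ℝ → ℝ)) : (ℝ → ℝ) × (ℝ → ℝ) :=
  (fun y => v.1 y - w.1 y, fun y => v.2 y - w.2 y)

/-- Squared `𝓗` norm. -/
def HnormSq (p : ℝ) (q : (ℝ → ℝ) × (ℝ → ℝ)) : ℝ :=
  ∫ y in (-1 : ℝ)..1, (q.1 y ^ 2 + (deriv q.1 y) ^ 2 * (1 - y ^ 2) + q.2 y ^ 2) * rho p y

/-- `𝓗` norm. -/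
def Hnorm (p : ℝ) (q : (ℝ → ℝ) × (ℝ → ℝ)) : ℝ := Real.sqrt (HnormSq p q)

/-- Membership in `𝓗` (finiteness of the norm, i.e. integrability of the integrand). -/
def memH (p : ℝ) (q : (ℝ → ℝ) × (ℝ → ℝ)) : Prop :=
  IntervalIntegrable
    (fun y => (q.1 y ^ 2 + (deriv q.1 y) ^ 2 * (1 - y ^ 2) + q.2 y ^ 2) * rho p y)
    volume (-1) 1

/-- Squared `𝓗₀` norm. -/
def H0normSq (p : ℝ) (h : ℝ → ℝ) : ℝ :=
  ∫ y in (-1 : ℝ)..1, (h y ^ 2 + (deriv h y) ^ 2 * (1 - y ^ 2)) * rho p y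

/-- Membership in `𝓗₀`. -/
def memH0 (p : ℝ) (h : ℝ → ℝ) : Prop :=
  IntervalIntegrable (fun y => (h y ^ 2 + (deriv h y) ^ 2 * (1 - y ^ 2)) * rho p y)
    volume (-1) 1

/-- The operator `𝓛 f = ρ⁻¹ ∂_y(ρ (1-y²) ∂_y f)`. -/
def Lop (p : ℝ) (f : ℝ → ℝ) (y : ℝ) : ℝ :=
  (1 / rho p y) * deriv (fun z => rho p z * (1 - z ^ 2) * deriv f z) y

/-- The similarity-variables equation (with the radial correction term) at `(y,s)`. -/
def SolvesSimEq (p : ℝ) (N : ℕ) (r0 : ℝ) (w : ℝ → ℝ → ℝ) (y s : ℝ) : Prop :=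
  deriv (fun s' => deriv (fun s'' => w y s'') s') s =
    Lop p (fun z => w z s) y - 2 * (p + 1) / (p - 1) ^ 2 * w y s +
      |w y s| ^ (p - 1) * w y s - (p + 3) / (p - 1) * deriv (fun s' => w y s') s -
      2 * y * deriv (fun z => deriv (fun s' => w z s') s) y +
      Real.exp (-s) * ((N : ℝ) - 1) / (r0 + y * Real.exp (-s)) *
        deriv (fun z => w z s) y

/-- The radial semilinear wave equation at `(r,t)`. -/
def SolvesRadial (p : ℝ) (N : ℕ) (u : ℝ → ℝ → ℝ) (r t : ℝ) : Prop :=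
  deriv (fun t' => deriv (fun t'' => u r t'') t') t =
    deriv (fun r' => deriv (fun r'' => u r'' t) r') r +
      ((N : ℝ) - 1) / r * deriv (fun r' => u r' t) r + |u r t| ^ (p - 1) * u r t

/-- The explicit solutions `û(d,ν,r₀,T,r,t)`. -/
def uhat (p d ν r0 T r t : ℝ) : ℝ :=
  kappa0 p * (1 - d ^ 2) ^ ((1 : ℝ) / (p - 1)) /
    ((1 + ν) * (T - t) + d * (r - r0)) ^ ((2 : ℝ) / (p - 1))

/-- Similarity variables: `w_{r₀,T₀}(y,s) = (T₀-t)^{2/(p-1)} u(r,t)` with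
`r = r₀ + y e^{-s}`, `t = T₀ - e^{-s}`. -/
def simVar (p r0 T0 : ℝ) (u : ℝ → ℝ → ℝ) (y s : ℝ) : ℝ :=
  Real.exp (-s) ^ ((2 : ℝ) / (p - 1)) * u (r0 + y * Real.exp (-s)) (T0 - Real.exp (-s))

/-- The pair `(w_{r₀,T₀}(s), ∂ₛ w_{r₀,T₀}(s))`. -/
def wpair (p r0 T0 : ℝ) (u : ℝ → ℝ → ℝ) (s : ℝ) : (ℝ → ℝ) × (ℝ → ℝ) :=
  (fun y => simVar p r0 T0 u y s, fun y => deriv (fun s' => simVar p r0 T0 u y s') s)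

/-- Squared unweighted `H¹ × L²(-1,1)` norm. -/
def H1L2normSq (q : (ℝ → ℝ) × (ℝ → ℝ)) : ℝ :=
  ∫ y in (-1 : ℝ)..1, (q.1 y ^ 2 + (deriv q.1 y) ^ 2 + q.2 y ^ 2)

/-- `arg tanh x = ½ log((1+x)/(1-x))`. -/
def arctanhR (x : ℝ) : ℝ := (1 / 2) * Real.log ((1 + x) / (1 - x))

/-- The inner product `φ` of the space `𝓗`. -/
def phiInner (p : ℝ) (q r : (ℝ → ℝ) × (ℝ → ℝ)) : ℝ :=
  ∫ y in (-1 : ℝ)..1,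
    (q.1 y * r.1 y + deriv q.1 y * deriv r.1 y * (1 - y ^ 2) + q.2 y * r.2 y) * rho p y

/-- The normalizing constants `c_λ`. -/
def clamConst (p : ℝ) (lam : ℕ) : ℝ :=
  (2 * ((lam : ℝ) + 2 / (p - 1)) *
    ∫ y in (-1 : ℝ)..1, (y ^ 2 / (1 - y ^ 2)) ^ ((1 : ℝ) - (lam : ℝ)) * rho p y)⁻¹

/-- `c_λ(d) = c_λ (1-d²)^{1/(p-1)}`. -/
def clam (p : ℝ) (lam : ℕ) (d : ℝ) : ℝ := clamConst p lam * (1 - d ^ 2) ^ ((1 : ℝ) / (p - 1))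

/-- Second components `W^d_{λ,2}` of the nonnegative directions. -/
def Wlam2 (p : ℝ) (lam : ℕ) (d y : ℝ) : ℝ :=
  if lam = 1 then clam p 1 d * (1 - y ^ 2) / (1 + d * y) ^ ((2 : ℝ) / (p - 1) + 1)
  else clam p 0 d * (y + d) / (1 + d * y) ^ ((2 : ℝ) / (p - 1) + 1)

/-- The defining property of the first component `W^d_{λ,1}`. -/
def IsW1 (p : ℝ) (lam : ℕ) (d : ℝ) (r : ℝ → ℝ) : Prop :=
  (∀ y ∈ Set.Ioo (-1 : ℝ) 1,
    -Lop p r y + r y = ((lam : ℝ) - (p + 3) / (p - 1)) * Wlam2 p lam d y -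
      2 * y * deriv (fun z => Wlam2 p lam d z) y +
      8 / (p - 1) * Wlam2 p lam d y / (1 - y ^ 2)) ∧
  memH p (r, fun y => Wlam2 p lam d y)

/-- The projections `π^d_λ(v) = φ(W^d_λ, v)`, relative to a family `W1` of
first components `W^d_{λ,1}`. -/
def projH (p : ℝ) (W1 : ℕ → ℝ → ℝ → ℝ) (lam : ℕ) (d : ℝ)
    (v : (ℝ → ℝ) × (ℝ → ℝ)) : ℝ :=
  phiInner p (fun y => W1 lam d y, fun y => Wlam2 p lam d y) v

/-- The potential `ψ_{d,ν}`. -/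
def psiFun (p d ν y : ℝ) : ℝ :=
  p * kappaStar1 p d ν y ^ (p - 1) - 2 * (p + 1) / (p - 1) ^ 2

/-- The quadratic form `φ_{d,ν}(q,q)`. -/
def phiForm (p d ν : ℝ) (q : (ℝ → ℝ) × (ℝ → ℝ)) : ℝ :=
  ∫ y in (-1 : ℝ)..1,
    ((deriv q.1 y) ^ 2 * (1 - y ^ 2) - psiFun p d ν y * q.1 y ^ 2 + q.2 y ^ 2) * rho p y

/-- The nonlinear remainder `f_{d,ν}(q₁)`. -/
def fSmall (p d ν y x : ℝ) : ℝ :=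
  |kappaStar1 p d ν y + x| ^ (p - 1) * (kappaStar1 p d ν y + x) -
    kappaStar1 p d ν y ^ p - p * kappaStar1 p d ν y ^ (p - 1) * x

/-- `𝓕_{ν,d}(x) = ∫₀ˣ f_{ν,d}(ξ) dξ`. -/
def FBig (p d ν y x : ℝ) : ℝ := ∫ ξ in (0 : ℝ)..x, fSmall p d ν y ξ

/-- `R = -∫ 𝓕_{ν,d}(q₁) dy`. -/
def Rfun (p d ν : ℝ) (q : (ℝ → ℝ) × (ℝ → ℝ)) : ℝ :=
  -∫ y in (-1 : ℝ)..1, FBig p d ν y (q.1 y)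

/-- `λ(d,ν) = (1-d²)^{1/(p-1)}/((1+ν)²-d²)^{1/(p-1)}`. -/
def lamFun (p d ν : ℝ) : ℝ :=
  (1 - d ^ 2) ^ ((1 : ℝ) / (p - 1)) / ((1 + ν) ^ 2 - d ^ 2) ^ ((1 : ℝ) / (p - 1))


/-- The base of the powers defining `κ*` is positive on the domain of definition. -/
lemma one_add_mul_add_pos {d ν y : ℝ} (hν : -1 + |d| < ν) (hy : y ∈ Ioo (-1 : ℝ) 1) :
    0 < 1 + d * y + ν := by
  have h : |d * y| ≤ |d| := by
    rw [abs_mul]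
    exact mul_le_of_le_one_right (abs_nonneg d) (abs_le.2 ⟨hy.1.le, hy.2.le⟩)
  linarith [neg_abs_le (d * y)]

lemma one_sub_sq_pos {x : ℝ} (hx : x ∈ Ioo (-1 : ℝ) 1) : 0 < 1 - x ^ 2 := by
  nlinarith [hx.1, hx.2]

lemma kappaStar1_eq {p d ν y : ℝ} (h : 0 < 1 + d * y + ν) :
    kappaStar1 p d ν y = kappa0 p * (1 - d ^ 2) ^ ((1 : ℝ) / (p - 1)) *
      (1 + d * y + ν) ^ (-(2 / (p - 1))) := by
  rw [kappaStar1, rpow_neg h.le, div_eq_mul_inv]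

lemma kappaStar2_eq {p d ν y : ℝ} (hp : 1 < p) (h : 0 < 1 + d * y + ν) :
    kappaStar2 p d ν y = -(2 / (p - 1)) * ν *
      (kappa0 p * (1 - d ^ 2) ^ ((1 : ℝ) / (p - 1))) *
      (1 + d * y + ν) ^ (-(2 / (p - 1)) - 1) := by
  have hp' : p - 1 ≠ 0 := by linarith
  have e : -(2 / (p - 1)) - 1 = -((p + 1) / (p - 1)) := by field_simp; ring
  rw [kappaStar2, e, rpow_neg h.le]
  ring

lemma hasDerivAt_rpow_affine_left {d ν y : ℝ} (b : ℝ) (h : 0 < 1 + d * y + ν) :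
    HasDerivAt (fun z => (1 + d * z + ν) ^ b) (d * b * (1 + d * y + ν) ^ (b - 1)) y := by
  have h1 : HasDerivAt (fun z => 1 + d * z + ν) d y := by
    simpa using (((hasDerivAt_id y).const_mul d).const_add 1).add_const ν
  exact h1.rpow_const (Or.inl h.ne')

lemma hasDerivAt_rpow_affine_right {d ν y : ℝ} (b : ℝ) (h : 0 < 1 + d * y + ν) :
    HasDerivAt (fun ν' => (1 + d * y + ν') ^ b) (b * (1 + d * y + ν) ^ (b - 1)) ν := by
  have h1 : HasDerivAt (fun ν' => 1 + d * y + ν') 1 ν := by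
    simpa using (hasDerivAt_id ν).const_add (1 + d * y)
  simpa using h1.rpow_const (p := b) (Or.inl h.ne')

lemma eventually_affine_pos_left {d ν y : ℝ} (h : 0 < 1 + d * y + ν) :
    ∀ᶠ z in nhds y, 0 < 1 + d * z + ν :=
  (by fun_prop : Continuous fun z => 1 + d * z + ν).continuousAt.eventually (lt_mem_nhds h)

lemma eventually_affine_pos_right {d ν y : ℝ} (h : 0 < 1 + d * y + ν) :
    ∀ᶠ ν' in nhds ν, 0 < 1 + d * y + ν' :=
  (by fun_prop : Continuous fun ν' => 1 + d * y + ν').continuousAt.eventually (lt_mem_nhds h)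

lemma hasDerivAt_kappaStar1_space {p d ν y : ℝ} (h : 0 < 1 + d * y + ν) :
    HasDerivAt (fun z => kappaStar1 p d ν z)
      (kappa0 p * (1 - d ^ 2) ^ ((1 : ℝ) / (p - 1)) *
        (d * -(2 / (p - 1)) * (1 + d * y + ν) ^ (-(2 / (p - 1)) - 1))) y :=
  ((hasDerivAt_rpow_affine_left _ h).const_mul _).congr_of_eventuallyEq
    ((eventually_affine_pos_left h).mono fun _ hz => kappaStar1_eq hz)

lemma hasDerivAt_kappaStar2_space {p d ν y : ℝ} (hp : 1 < p) (h : 0 < 1 + d * y + ν) :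
    HasDerivAt (fun z => kappaStar2 p d ν z)
      (-(2 / (p - 1)) * ν * (kappa0 p * (1 - d ^ 2) ^ ((1 : ℝ) / (p - 1))) *
        (d * (-(2 / (p - 1)) - 1) * (1 + d * y + ν) ^ (-(2 / (p - 1)) - 1 - 1))) y :=
  ((hasDerivAt_rpow_affine_left _ h).const_mul _).congr_of_eventuallyEq
    ((eventually_affine_pos_left h).mono fun _ hz => kappaStar2_eq hp hz)

lemma hasDerivAt_kappaStar1_param {p d ν y : ℝ} (h : 0 < 1 + d * y + ν) :
    HasDerivAt (fun ν' => kappaStar1 p d ν' y)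
      (kappa0 p * (1 - d ^ 2) ^ ((1 : ℝ) / (p - 1)) *
        (-(2 / (p - 1)) * (1 + d * y + ν) ^ (-(2 / (p - 1)) - 1))) ν :=
  ((hasDerivAt_rpow_affine_right _ h).const_mul _).congr_of_eventuallyEq
    ((eventually_affine_pos_right h).mono fun _ hz => kappaStar1_eq hz)

lemma hasDerivAt_kappaStar2_param {p d ν y : ℝ} (hp : 1 < p) (h : 0 < 1 + d * y + ν) :
    HasDerivAt (fun ν' => kappaStar2 p d ν' y)
      (-(2 / (p - 1)) * (kappa0 p * (1 - d ^ 2) ^ ((1 : ℝ) / (p - 1))) *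
        ((1 + d * y + ν) ^ (-(2 / (p - 1)) - 1) +
          ν * ((-(2 / (p - 1)) - 1) * (1 + d * y + ν) ^ (-(2 / (p - 1)) - 1 - 1)))) ν := by
  have h1 := (((hasDerivAt_id ν).mul (hasDerivAt_rpow_affine_right (-(2 / (p - 1)) - 1) h)).const_mul
    (-(2 / (p - 1)) * (kappa0 p * (1 - d ^ 2) ^ ((1 : ℝ) / (p - 1)))))
  refine (h1.congr_deriv ?_).congr_of_eventuallyEq
    ((eventually_affine_pos_right h).mono fun ν' hz => ?_)
  · simp only [id, one_mul]
  · simp only [kappaStar2_eq hp hz, Pi.mul_apply, id]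
    ring

lemma Lop_congr {p y : ℝ} {f g : ℝ → ℝ} (h : f =ᶠ[nhds y] g) : Lop p f y = Lop p g y := by
  unfold Lop
  congr 1
  refine Filter.EventuallyEq.deriv_eq ?_
  filter_upwards [h.deriv] with z hz
  rw [hz]

/-- The operator `𝓛` in nondivergence form. -/
lemma Lop_eq {p y f'' : ℝ} {f f' : ℝ → ℝ} (hy : y ∈ Ioo (-1 : ℝ) 1)
    (hf : ∀ᶠ z in nhds y, HasDerivAt f (f' z) z) (hf' : HasDerivAt f' f'' y) :
    Lop p f y = (1 - y ^ 2) * f'' - 2 * (2 / (p - 1) + 1) * y * f' y := by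
  have hpos := one_sub_sq_pos hy
  have hρ : 0 < rho p y := rpow_pos_of_pos hpos _
  have hq : HasDerivAt (fun z : ℝ => 1 - z ^ 2) (-(2 * y)) y := by
    simpa using (hasDerivAt_pow 2 y).const_sub 1
  have hw : HasDerivAt (fun z => rho p z * (1 - z ^ 2))
      (-(2 * (2 / (p - 1) + 1) * y) * rho p y) y := by
    refine ((hq.rpow_const (p := 2 / (p - 1)) (Or.inl hpos.ne')).mul hq).congr_deriv ?_
    rw [rpow_sub_one hpos.ne']
    unfold rho
    field_simp
    ring
  have hd : deriv (fun z => rho p z * (1 - z ^ 2) * deriv f z) y =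
      -(2 * (2 / (p - 1) + 1) * y) * rho p y * f' y + rho p y * (1 - y ^ 2) * f'' := by
    rw [← (hw.mul hf').deriv]
    refine Filter.EventuallyEq.deriv_eq ?_
    filter_upwards [hf] with z hz
    rw [hz.deriv, Pi.mul_apply]
  rw [Lop, hd]
  field_simp
  ring

lemma Lop_kappaStar1 {p d ν y : ℝ} (hy : y ∈ Ioo (-1 : ℝ) 1)
    (h : 0 < 1 + d * y + ν) :
    Lop p (fun z => kappaStar1 p d ν z) y =
      kappa0 p * (1 - d ^ 2) ^ ((1 : ℝ) / (p - 1)) * (2 / (p - 1)) * (2 / (p - 1) + 1) * d *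
        ((1 - y ^ 2) * d * (1 + d * y + ν) ^ (-(2 / (p - 1)) - 1 - 1) +
          2 * y * (1 + d * y + ν) ^ (-(2 / (p - 1)) - 1)) := by
  rw [Lop_eq hy
    ((eventually_affine_pos_left h).mono fun z hz => hasDerivAt_kappaStar1_space hz)
    (((hasDerivAt_rpow_affine_left _ h).const_mul _).const_mul _)]
  ring

lemma kappa0_pos {p : ℝ} (hp : 1 < p) : 0 < kappa0 p := by
  have : 0 < p - 1 := by linarith
  unfold kappa0
  positivity

lemma kappaStar1_pos {p d ν y : ℝ} (hp : 1 < p) (hd : d ∈ Ioo (-1 : ℝ) 1)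
    (h : 0 < 1 + d * y + ν) : 0 < kappaStar1 p d ν y :=
  div_pos (mul_pos (kappa0_pos hp) (rpow_pos_of_pos (one_sub_sq_pos hd) _)) (rpow_pos_of_pos h _)

lemma kappaStar1_rpow_sub_one {p d ν y : ℝ} (hp : 1 < p) (hd : d ∈ Ioo (-1 : ℝ) 1)
    (h : 0 < 1 + d * y + ν) :
    kappaStar1 p d ν y ^ (p - 1) =
      2 * (p + 1) / (p - 1) ^ 2 * (1 - d ^ 2) / (1 + d * y + ν) ^ 2 := by
  have hp' : 0 < p - 1 := by linarith
  have hd' := one_sub_sq_pos hd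
  have e1 : 1 / (p - 1) * (p - 1) = 1 := by field_simp
  have e2 : 2 / (p - 1) * (p - 1) = 2 := by field_simp
  have hk := kappa0_pos hp
  rw [kappaStar1, div_rpow (by positivity) (by positivity), mul_rpow hk.le (by positivity),
    kappa0, ← rpow_mul (by positivity), ← rpow_mul hd'.le, ← rpow_mul h.le, e1, e2,
    rpow_one, rpow_one, rpow_two]

lemma kappaStar1_rpow {p d ν y : ℝ} (hp : 1 < p) (hd : d ∈ Ioo (-1 : ℝ) 1)
    (h : 0 < 1 + d * y + ν) :
    kappaStar1 p d ν y ^ p = kappaStar1 p d ν y ^ (p - 1) * kappaStar1 p d ν y := by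
  have hk := kappaStar1_pos hp hd h
  rw [← rpow_add_one hk.ne', sub_add_cancel]

lemma mul_deriv_kappaStar1 {p d ν y : ℝ} (hp : 1 < p) (h : 0 < 1 + d * y + ν) :
    ν * deriv (fun ν' => kappaStar1 p d ν' y) ν = kappaStar2 p d ν y := by
  rw [(hasDerivAt_kappaStar1_param h).deriv, kappaStar2_eq hp h]
  ring

lemma mul_deriv_kappaStar2 {p d ν y : ℝ} (hp : 1 < p) (hd : d ∈ Ioo (-1 : ℝ) 1)
    (hy : y ∈ Ioo (-1 : ℝ) 1) (h : 0 < 1 + d * y + ν) :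
    ν * deriv (fun ν' => kappaStar2 p d ν' y) ν =
      Lop p (fun z => kappaStar1 p d ν z) y -
        2 * (p + 1) / (p - 1) ^ 2 * kappaStar1 p d ν y +
        kappaStar1 p d ν y ^ p -
        (p + 3) / (p - 1) * kappaStar2 p d ν y -
        2 * y * deriv (fun z => kappaStar2 p d ν z) y := by
  have hp' : p - 1 ≠ 0 := by linarith
  rw [(hasDerivAt_kappaStar2_param hp h).deriv, Lop_kappaStar1 hy h,
    (hasDerivAt_kappaStar2_space hp h).deriv, kappaStar1_rpow hp hd h,
    kappaStar1_rpow_sub_one hp hd h, kappaStar2_eq hp h, kappaStar1_eq h,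
    rpow_sub_one h.ne' (-(2 / (p - 1)) - 1), rpow_sub_one h.ne' (-(2 / (p - 1)))]
  generalize (1 + d * y + ν) ^ (-(2 / (p - 1))) = U
  generalize kappa0 p * (1 - d ^ 2) ^ (1 / (p - 1)) = C
  have hu := h.ne'
  field_simp
  ring

lemma kappaSol_eq_kappaStar1 {p d y : ℝ} (hd : d ∈ Ioo (-1 : ℝ) 1) (h : 0 < 1 + d * y + 0) :
    kappaSol p d y = kappaStar1 p d 0 y := by
  have hd' := one_sub_sq_pos hd
  rw [add_zero] at h
  rw [kappaSol, kappaStar1, add_zero, div_rpow hd'.le (by positivity), ← rpow_natCast (1 + d * y),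
    ← rpow_mul h.le, mul_div_assoc]
  congr 4
  ring

lemma kappaSol_stationary {p d y : ℝ} (hp : 1 < p) (hd : d ∈ Ioo (-1 : ℝ) 1)
    (hy : y ∈ Ioo (-1 : ℝ) 1) :
    Lop p (fun z => kappaSol p d z) y - 2 * (p + 1) / (p - 1) ^ 2 * kappaSol p d y +
      kappaSol p d y ^ p = 0 := by
  have h : 0 < 1 + d * y + 0 :=
    one_add_mul_add_pos (by linarith [abs_lt.2 ⟨hd.1, hd.2⟩]) hy
  have key := mul_deriv_kappaStar2 hp hd hy h
  have h2 : ∀ z, kappaStar2 p d 0 z = 0 := fun z => by simp [kappaStar2]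
  simp only [h2, deriv_const, zero_mul, mul_zero, sub_zero] at key
  rw [Lop_congr ((eventually_affine_pos_left h).mono fun _ hz => kappaSol_eq_kappaStar1 hd hz),
    kappaSol_eq_kappaStar1 hd h]
  exact key.symm

/-- Along `ν = μ eˢ`, the derivative `∂ₛ` is `ν ∂_ν`. -/
lemma deriv_comp_mul_exp {f : ℝ → ℝ} {μ s : ℝ} (hf : DifferentiableAt ℝ f (μ * Real.exp s)) :
    deriv (fun s' => f (μ * Real.exp s')) s = μ * Real.exp s * deriv f (μ * Real.exp s) := by
  rw [mul_comm]
  exact (hf.hasDerivAt.comp s ((Real.hasDerivAt_exp s).const_mul μ)).deriv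

/-- the generalized solitons solve the one-dimensional similarity
equation; the solitons `κ(d)` are stationary solutions: for every `|d| < 1`, `μ ∈ ℝ`,
`(y,s) ↦ κ*(d, μeˢ, y)` solves the first-order vector-valued formulation of the
one-dimensional similarity equation on its domain; equivalently
`ν ∂_ν κ₁* = κ₂*` and
`ν ∂_ν κ₂* = 𝓛κ₁* - (2(p+1)/(p-1)²)κ₁* + (κ₁*)^p - ((p+3)/(p-1))κ₂* - 2y ∂_y κ₂*`;
in particular `𝓛κ(d) - (2(p+1)/(p-1)²)κ(d) + κ(d)^p = 0` on `(-1,1)`. -/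
theorem kappaStar_solves_similarity_equation (p : ℝ) (hp : 1 < p) :
    ∀ d ∈ Set.Ioo (-1 : ℝ) 1, ∀ y ∈ Set.Ioo (-1 : ℝ) 1,
      -- the first-order formulation for `(y,s) ↦ κ*(d, μ eˢ, y)`
      (∀ μ s : ℝ, -1 + |d| < μ * Real.exp s →
        deriv (fun s' => kappaStar1 p d (μ * Real.exp s') y) s =
          kappaStar2 p d (μ * Real.exp s) y ∧
        deriv (fun s' => kappaStar2 p d (μ * Real.exp s') y) s =
          Lop p (fun z => kappaStar1 p d (μ * Real.exp s) z) y -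
            2 * (p + 1) / (p - 1) ^ 2 * kappaStar1 p d (μ * Real.exp s) y +
            |kappaStar1 p d (μ * Real.exp s) y| ^ (p - 1) *
              kappaStar1 p d (μ * Real.exp s) y -
            (p + 3) / (p - 1) * kappaStar2 p d (μ * Real.exp s) y -
            2 * y * deriv (fun z => kappaStar2 p d (μ * Real.exp s) z) y) ∧
      -- equivalently, in terms of `ν ∂_ν`
      (∀ ν : ℝ, -1 + |d| < ν →
        ν * deriv (fun ν' => kappaStar1 p d ν' y) ν = kappaStar2 p d ν y ∧
        ν * deriv (fun ν' => kappaStar2 p d ν' y) ν =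
          Lop p (fun z => kappaStar1 p d ν z) y -
            2 * (p + 1) / (p - 1) ^ 2 * kappaStar1 p d ν y +
            kappaStar1 p d ν y ^ p -
            (p + 3) / (p - 1) * kappaStar2 p d ν y -
            2 * y * deriv (fun z => kappaStar2 p d ν z) y) ∧
      -- in particular, `κ(d)` is a stationary solution
      Lop p (fun z => kappaSol p d z) y - 2 * (p + 1) / (p - 1) ^ 2 * kappaSol p d y +
          kappaSol p d y ^ p = 0 := by
  intro d hd y hy
  refine ⟨fun μ s hν => ?_, fun ν hν => ?_, kappaSol_stationary hp hd hy⟩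
  · have h := one_add_mul_add_pos hν hy
    rw [abs_of_pos (kappaStar1_pos hp hd h), ← kappaStar1_rpow hp hd h,
      deriv_comp_mul_exp (f := fun ν' => kappaStar1 p d ν' y)
        (hasDerivAt_kappaStar1_param h).differentiableAt,
      deriv_comp_mul_exp (f := fun ν' => kappaStar2 p d ν' y)
        (hasDerivAt_kappaStar2_param hp h).differentiableAt]
    exact ⟨mul_deriv_kappaStar1 hp h, mul_deriv_kappaStar2 hp hd hy h⟩
  · have h := one_add_mul_add_pos hν hy
    exact ⟨mul_deriv_kappaStar1 hp h, mul_deriv_kappaStar2 hp hd hy h⟩
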